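/- Let G be a finite connected simple graph and E a subset of E(G). Then G admits an E-restricted double trace if and only if the graph G - E obtained from G by deleting the edges in E is an even graph, that is, every vertex of G is incident with an even number of edges of E(G) \ E. -/

import Mathlib

open SimpleGraph

/-- A closed walk is a *double trace* if it traverses every edge of the graph exactly twice. -/
def IsDoubleTrace {V : Type*} [DecidableEq V] {G : SimpleGraph V} {x : V} (w : G.Walk x x) : Prop :=
  ∀ e ∈ G.edgeSet, w.edges.count e = 2

/-- The number of times a walk traverses the edge between `a` and `b`
in the direction from `a` to `b`. -/
def traversals {V : Type*} [DecidableEq V] {G : SimpleGraph V} {x y : V} (w : G.Walk x y)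
    (a b : V) : ℕ :=
  (w.darts.map SimpleGraph.Dart.toProd).count (a, b)

/-- A closed walk `w` has an `N`-repetition at `v`: whenever `w` visits `v` (indices taken
cyclically), the predecessor vertex lies in `N` iff the successor vertex lies in `N`. -/
def HasRepetition {V : Type*} {G : SimpleGraph V} {x : V} (w : G.Walk x x) (v : V)
    (N : Set V) : Prop :=
  ∀ i < w.length, w.getVert i = v →
    ((w.getVert ((i + w.length - 1) % w.length) ∈ N) ↔ (w.getVert ((i + 1) % w.length) ∈ N))

/-- A *strong trace* is a double trace without nontrivial repetitions: there is no vertex `v`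
and set `N` of neighbours of `v`, nonempty and proper in `N(v)`, forming an `N`-repetition. -/
def IsStrongTrace {V : Type*} [DecidableEq V] {G : SimpleGraph V} {x : V} (w : G.Walk x x) : Prop :=
  IsDoubleTrace w ∧
    ∀ (v : V) (N : Set V), N ⊆ G.neighborSet v → N.Nonempty → N ≠ G.neighborSet v →
      ¬ HasRepetition w v N

/-- A *`d`-stable trace* is a double trace without `N`-repetitions for sets `N` of neighbours
with `1 ≤ |N| ≤ d`. -/
def IsStableTrace {V : Type*} [DecidableEq V] {G : SimpleGraph V} (d : ℕ) {x : V}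
    (w : G.Walk x x) : Prop :=
  IsDoubleTrace w ∧
    ∀ (v : V) (N : Set V), N ⊆ G.neighborSet v → 1 ≤ N.ncard → N.ncard ≤ d →
      ¬ HasRepetition w v N

/-- A closed walk is *antiparallel* if it traverses every edge once in each direction. -/
def IsAntiparallel {V : Type*} [DecidableEq V] {G : SimpleGraph V} {x : V}
    (w : G.Walk x x) : Prop :=
  ∀ a b, G.Adj a b → traversals w a b = 1 ∧ traversals w b a = 1

/-- A closed walk is *parallel* if it traverses every edge twice in the same direction. -/
def IsParallel {V : Type*} [DecidableEq V] {G : SimpleGraph V} {x : V}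
    (w : G.Walk x x) : Prop :=
  ∀ a b, G.Adj a b →
    (traversals w a b = 2 ∧ traversals w b a = 0) ∨
      (traversals w a b = 0 ∧ traversals w b a = 2)

/-- `T` is a spanning tree of `G`: a connected acyclic spanning subgraph. -/
def IsSpanningTree {V : Type*} (G T : SimpleGraph V) : Prop :=
  T ≤ G ∧ T.Connected ∧ T.IsAcyclic

/-- The number of edges of `H` lying in the connected component `C` of `H`. -/
noncomputable def componentEdgeCount {V : Type*} (H : SimpleGraph V)
    (C : H.ConnectedComponent) : ℕ :=
  {e : Sym2 V | e ∈ H.edgeSet ∧ ∀ a ∈ e, a ∈ C.supp}.ncard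


section Aux
open Finset

variable {V : Type*} [DecidableEq V]

theorem trav_nil' {G : SimpleGraph V} (x a b : V) :
    traversals (Walk.nil : G.Walk x x) a b = 0 := by
  simp [traversals]

theorem trav_cons' {G : SimpleGraph V} {x y z : V} (h : G.Adj x y) (p : G.Walk y z) (a b : V) :
    traversals (Walk.cons h p) a b = traversals p a b + if x = a ∧ y = b then 1 else 0 := by
  simp [traversals, List.count_cons]

theorem trav_append' {G : SimpleGraph V} {x y z : V} (p : G.Walk x y) (q : G.Walk y z) (a b : V) :
    traversals (p.append q) a b = traversals p a b + traversals q a b := by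
  simp [traversals, Walk.darts_append]

theorem trav_rotate' {G : SimpleGraph V} {x y : V} (p : G.Walk x x) (h : y ∈ p.support) (a b : V) :
    traversals (p.rotate y h) a b = traversals p a b := by
  unfold traversals
  exact ((p.rotate_darts y h).perm.map _).count_eq _

theorem trav_adj' {G : SimpleGraph V} {x y : V} (p : G.Walk x y) (a b : V)
    (h : traversals p a b ≠ 0) : G.Adj a b ∧ a ∈ p.support ∧ b ∈ p.support := by
  have h1 : (a, b) ∈ p.darts.map SimpleGraph.Dart.toProd := by
    by_contra hc
    exact h (List.count_eq_zero_of_not_mem hc)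
  obtain ⟨d, hd, hd2⟩ := List.mem_map.1 h1
  have e1 : d.fst = a := congrArg Prod.fst hd2
  have e2 : d.snd = b := congrArg Prod.snd hd2
  refine ⟨?_, ?_, ?_⟩
  · rw [← e1, ← e2]; exact d.adj
  · rw [← e1]; exact p.dart_fst_mem_support_of_mem_darts hd
  · rw [← e2]; exact p.dart_snd_mem_support_of_mem_darts hd

theorem count_edges' {G : SimpleGraph V} {x y : V} (p : G.Walk x y) (a b : V) (hab : a ≠ b) :
    p.edges.count s(a, b) = traversals p a b + traversals p b a := by
  induction p with
  | nil => simp [traversals]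
  | cons h p ih =>
    rw [Walk.edges_cons, List.count_cons, ih, trav_cons', trav_cons']
    simp only [beq_iff_eq, Sym2.eq_iff]
    split_ifs <;> grind

variable [Fintype V]

theorem trav_bal' {G : SimpleGraph V} {x y : V} (p : G.Walk x y) (v : V) :
    (∑ b, traversals p v b) + (if v = y then 1 else 0) =
      (∑ b, traversals p b v) + (if v = x then 1 else 0) := by
  induction p with
  | nil => simp [traversals]
  | @cons x z y h p ih =>
    simp only [trav_cons', sum_add_distrib]
    have h1 : (∑ b, if x = v ∧ z = b then 1 else 0) = if v = x then 1 else 0 := by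
      by_cases hx : x = v
      · simp [hx]
      · simp [hx, Ne.symm hx]
    have h2 : (∑ b, if x = b ∧ z = v then 1 else 0) = if v = z then 1 else 0 := by
      by_cases hx : z = v
      · simp [hx]
      · simp [hx, Ne.symm hx]
    rw [h1, h2]
    omega

theorem trav_length' {G : SimpleGraph V} {x y : V} (p : G.Walk x y) :
    ∑ a, ∑ b, traversals p a b = p.length := by
  induction p with
  | nil => simp [traversals]
  | @cons x z y h p ih =>
    simp only [trav_cons', sum_add_distrib, Walk.length_cons, ih]
    congr 1
    rw [Finset.sum_eq_single x]
    · simp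
    · intro b _ hb
      simp [hb.symm]
    · simp

theorem exists_longest' (G : SimpleGraph V) (f : V → V → ℕ) (x₀ : V) :
    ∃ (x y : V) (w : G.Walk x y), (∀ a b, traversals w a b ≤ f a b) ∧
      ∀ (x' y' : V) (w' : G.Walk x' y'), (∀ a b, traversals w' a b ≤ f a b) →
        w'.length ≤ w.length := by
  classical
  let P : ℕ → Prop := fun n => ∃ (x y : V) (w : G.Walk x y),
    (∀ a b, traversals w a b ≤ f a b) ∧ w.length = n
  have hP0 : P 0 := ⟨x₀, x₀, Walk.nil, by simp [trav_nil'], rfl⟩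
  have hb : ∀ (x y : V) (w : G.Walk x y), (∀ a b, traversals w a b ≤ f a b) →
      w.length ≤ ∑ a, ∑ b, f a b := by
    intro x y w hw
    rw [← trav_length']
    exact sum_le_sum fun a _ => sum_le_sum fun b _ => hw a b
  obtain ⟨x, y, w, hw, hl⟩ := Nat.findGreatest_spec (P := P) (Nat.zero_le (∑ a, ∑ b, f a b)) hP0
  refine ⟨x, y, w, hw, fun x' y' w' hw' => ?_⟩
  rw [hl]
  exact Nat.le_findGreatest (hb _ _ _ hw') ⟨x', y', w', hw', rfl⟩

theorem exists_euler' (G : SimpleGraph V) (hG : G.Connected) (f : V → V → ℕ)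
    (hf : ∀ a b, G.Adj a b → 0 < f a b + f b a) (hf0 : ∀ a b, f a b ≠ 0 → G.Adj a b)
    (hbal : ∀ v, ∑ b, f v b = ∑ b, f b v) :
    ∃ (x : V) (w : G.Walk x x), ∀ a b, traversals w a b = f a b := by
  obtain ⟨x₀⟩ := hG.nonempty
  obtain ⟨x, y, w, hw, hmax⟩ := exists_longest' G f x₀
  -- out-edges at the endpoint are used up
  have key : ∀ (x' y' : V) (w' : G.Walk x' y'), (∀ a b, traversals w' a b ≤ f a b) →
      w'.length = w.length → ∀ b, traversals w' y' b = f y' b := by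
    intro x' y' w' hw' hl b
    by_contra hne
    have hlt : traversals w' y' b < f y' b := lt_of_le_of_ne (hw' _ _) hne
    have hadj : G.Adj y' b := hf0 _ _ (by omega)
    have := hmax _ _ (w'.append (Walk.cons hadj Walk.nil)) (by
      intro a c
      rw [trav_append', trav_cons', trav_nil']
      have := hw' a c
      split_ifs with h
      · obtain ⟨rfl, rfl⟩ := h
        omega
      · omega)
    simp at this
    omega
  have hxy : x = y := by
    by_contra hne
    have h1 := trav_bal' w y
    have h2 : ∑ b, traversals w y b = ∑ b, f y b := sum_congr rfl fun b _ => key _ _ w hw rfl b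
    have h3 : ∑ b, traversals w b y ≤ ∑ b, f b y := sum_le_sum fun b _ => hw b y
    have h4 := hbal y
    rw [if_pos rfl, if_neg (Ne.symm hne)] at h1
    omega
  subst hxy
  have hout : ∀ v ∈ w.support, ∀ b, traversals w v b = f v b := by
    intro v hv b
    have := key v v (w.rotate v hv) (by intro a b; rw [trav_rotate']; exact hw a b)
      (by rw [← trav_length', ← trav_length']; simp only [trav_rotate']) b
    rwa [trav_rotate'] at this
  have hin : ∀ v ∈ w.support, ∀ b, traversals w b v = f b v := by
    intro v hv
    have h1 := trav_bal' w v
    have h2 : ∑ b, traversals w v b = ∑ b, f v b := sum_congr rfl fun b _ => hout v hv b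
    have h4 := hbal v
    have h5 : ∑ b, traversals w b v = ∑ b, f b v := by omega
    have h6 := (sum_eq_sum_iff_of_le (fun b _ => hw b v)).1 h5
    exact fun b => h6 b (mem_univ b)
  have hall : ∀ v, v ∈ w.support := by
    intro v
    obtain ⟨q⟩ := hG.preconnected x v
    have : ∀ (a b : V) (q : G.Walk a b), a ∈ w.support → b ∈ w.support := by
      intro a b q
      induction q with
      | nil => exact id
      | @cons a c b h q ih =>
        intro ha
        apply ih
        have h0 := hf a c h
        rw [← hout a ha c, ← hin a ha c] at h0
        by_cases h1 : traversals w a c = 0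
        · exact (trav_adj' w c a (by omega)).2.1
        · exact (trav_adj' w a c h1).2.2
    exact this x v q w.start_mem_support
  exact ⟨x, w, fun a b => hout a (hall a) b⟩

theorem exists_orient' (n : ℕ) : ∀ (h : V → V → ℕ) (_ : ∀ a b, h a b = h b a)
    (_ : ∀ a, h a a = 0) (_ : ∑ a, ∑ b, h a b ≤ n) (u v : V)
    (_ : ∀ x, Even (∑ b, h x b + (if x = u then 1 else 0) + (if x = v then 1 else 0))),
    ∃ o : V → V → ℕ, (∀ a b, o a b + o b a = h a b) ∧
      ∀ x, ∑ b, o x b + (if x = v then 1 else 0) = ∑ b, o b x + (if x = u then 1 else 0) := by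
  induction n with
  | zero =>
    intro h hs hd hn u v hev
    have h0 : ∀ a b, h a b = 0 := by
      simpa using hn
    refine ⟨fun _ _ => 0, fun a b => (h0 a b).symm, fun x => ?_⟩
    have := hev x
    have h1 := hev u
    simp only [h0] at this h1
    by_cases huv : u = v
    · subst huv; rfl
    · simp [huv] at h1
  | succ n ih =>
    have main : ∀ (h : V → V → ℕ) (_ : ∀ a b, h a b = h b a)
        (_ : ∀ a, h a a = 0) (_ : ∑ a, ∑ b, h a b ≤ n + 1) (u v z : V) (_ : h u z ≠ 0)
        (_ : ∀ x, Even (∑ b, h x b + (if x = u then 1 else 0) + (if x = v then 1 else 0))),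
        ∃ o : V → V → ℕ, (∀ a b, o a b + o b a = h a b) ∧
          ∀ x, ∑ b, o x b + (if x = v then 1 else 0) =
            ∑ b, o b x + (if x = u then 1 else 0) := by
      intro h hs hd hn u v z huz hev
      have hne : u ≠ z := by rintro rfl; exact huz (hd u)
      let d : V → V → ℕ := fun a b => if u = a ∧ z = b then 1 else 0
      have dl : ∀ x, ∑ b, d x b = if x = u then 1 else 0 := by
        intro x
        by_cases hx : u = x <;> simp [d, hx, eq_comm]
      have dr : ∀ x, ∑ b, d b x = if x = z then 1 else 0 := by
        intro x
        by_cases hx : z = x <;> simp [d, hx, eq_comm]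
      let h' : V → V → ℕ := fun a b => h a b - d a b - d b a
      have hh : ∀ a b, h a b = h' a b + d a b + d b a := by
        intro a b
        have : d a b + d b a ≤ h a b := by
          have := hs u z
          simp only [d]
          split_ifs with h1 h2 h2
          · grind
          · grind
          · grind
          · omega
        simp only [h']
        omega
      have hsum : ∀ x, ∑ b, h x b = ∑ b, h' x b + (if x = u then 1 else 0)
          + (if x = z then 1 else 0) := by
        intro x
        rw [← dl, ← dr, ← sum_add_distrib, ← sum_add_distrib]
        exact sum_congr rfl fun b _ => hh x b
      obtain ⟨o, ho1, ho2⟩ := ih h' (by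
          intro a b
          have := hs a b
          simp only [h']
          omega) (by
          intro a
          simp [h', hd]) (by
          simp only [hsum, sum_add_distrib] at hn
          simp at hn
          omega) z v (by
          intro x
          have := hev x
          rw [hsum] at this
          grind)
      refine ⟨fun a b => o a b + d a b, fun a b => ?_, fun x => ?_⟩
      · have := ho1 a b
        have := hh a b
        dsimp only
        omega
      · have := ho2 x
        simp only [sum_add_distrib, dl, dr]
        omega
    intro h hs hd hn u v hev
    by_cases huz : ∃ z, h u z ≠ 0
    · obtain ⟨z, hz⟩ := huz
      exact main h hs hd hn u v z hz hev
    · push Not at huz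
      have huv : u = v := by
        by_contra hne
        have := hev u
        simp [huz, hne] at this
      subst huv
      by_cases hz : ∃ a z, h a z ≠ 0
      · obtain ⟨a, z, hz⟩ := hz
        obtain ⟨o, h1, h2⟩ := main h hs hd hn a a z hz (by
          intro x
          have := hev x
          grind)
        exact ⟨o, h1, fun x => by have := h2 x; omega⟩
      · push Not at hz
        exact ⟨fun _ _ => 0, fun a b => (hz a b).symm, fun x => rfl⟩

open Classical in
theorem ncard_eq' (G : SimpleGraph V) (E : Set (Sym2 V)) (v : V) :
    {e : Sym2 V | e ∈ G.edgeSet ∧ e ∉ E ∧ v ∈ e}.ncard =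
      ∑ b, if G.Adj v b ∧ s(v, b) ∉ E then 1 else 0 := by
  have h1 : {e : Sym2 V | e ∈ G.edgeSet ∧ e ∉ E ∧ v ∈ e} =
      (fun b => s(v, b)) '' {b | G.Adj v b ∧ s(v, b) ∉ E} := by
    ext e
    constructor
    · rintro ⟨h1, h2, b, rfl⟩
      exact ⟨b, ⟨h1, h2⟩, rfl⟩
    · rintro ⟨b, ⟨h1, h2⟩, rfl⟩
      exact ⟨h1, h2, by simp⟩
  rw [h1, Set.ncard_image_of_injective _ (fun a b h => Sym2.congr_right.1 h),
    Set.ncard_eq_toFinset_card']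
  simp

end Aux

/-- A finite connected simple graph `G` admits an `E`-restricted double trace (a double trace
in which every edge of `E` is antiparallel and every other edge is parallel) iff every vertex
of `G` is incident with an even number of edges of `E(G) \ E`. -/
theorem exists_restricted_double_trace_iff {V : Type*} [Fintype V] [DecidableEq V]
    (G : SimpleGraph V) (hG : G.Connected) (E : Set (Sym2 V)) (hE : E ⊆ G.edgeSet) :
    (∃ (x : V) (w : G.Walk x x), IsDoubleTrace w ∧
        (∀ a b, G.Adj a b → s(a, b) ∈ E →
          traversals w a b = 1 ∧ traversals w b a = 1) ∧
        (∀ a b, G.Adj a b → s(a, b) ∉ E →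
          (traversals w a b = 2 ∧ traversals w b a = 0) ∨
            (traversals w a b = 0 ∧ traversals w b a = 2))) ↔
      ∀ v : V, Even {e : Sym2 V | e ∈ G.edgeSet ∧ e ∉ E ∧ v ∈ e}.ncard := by
  classical
  have hEs : ∀ a b, s(a, b) ∈ E ↔ s(b, a) ∈ E := fun a b => by rw [Sym2.eq_swap]
  have hEa : ∀ a b, s(a, b) ∈ E → G.Adj a b := fun a b h => hE h
  have hcomm : ∀ a b, G.Adj a b ↔ G.Adj b a := fun a b => G.adj_comm a b
  simp only [ncard_eq']
  constructor
  · rintro ⟨x, w, -, hanti, hpar⟩ v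
    let o : V → V → ℕ := fun a b => if s(a, b) ∈ E then 0 else traversals w a b / 2
    have hna : ∀ a b, ¬ G.Adj a b → traversals w a b = 0 := by
      intro a b h
      by_contra hc
      exact h (trav_adj' w a b hc).1
    have h1 : ∀ a b, traversals w a b = (if s(a, b) ∈ E then 1 else 0) + 2 * o a b := by
      intro a b
      have := hna a b
      have := hanti a b
      have := hpar a b
      have := hEa a b
      simp only [o]
      split_ifs <;> grind
    have h2 : ∀ a b, (if G.Adj a b ∧ s(a, b) ∉ E then 1 else 0) = o a b + o b a := by
      intro a b
      have := hna a b
      have := hna b a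
      have := hpar a b
      have := hcomm a b
      have := hEs a b
      simp only [o]
      split_ifs <;> grind
    have hb := trav_bal' w v
    simp only [h1, Finset.sum_add_distrib, ← Finset.mul_sum, hEs _ v] at hb
    simp only [h2, Finset.sum_add_distrib]
    exact ⟨∑ b, o v b, by omega⟩
  · intro hev
    obtain ⟨x₀⟩ := hG.nonempty
    obtain ⟨o, ho1, ho2⟩ := exists_orient' _
      (fun a b => if G.Adj a b ∧ s(a, b) ∉ E then 1 else 0)
      (by intro a b; simp only [hcomm a b, hEs a b]) (by simp) le_rfl x₀ x₀ (by
        intro x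
        have := hev x
        grind)
    obtain ⟨x, w, hw⟩ := exists_euler' G hG
      (fun a b => (if s(a, b) ∈ E then 1 else 0) + 2 * o a b)
      (by
        intro a b hab
        have := ho1 a b
        split_ifs at this ⊢ <;> grind)
      (by
        intro a b hab
        have := ho1 a b
        have := hEa a b
        by_contra hc
        split_ifs at * <;> grind)
      (by
        intro v
        have := ho2 v
        simp only [Finset.sum_add_distrib, ← Finset.mul_sum, hEs _ v]
        omega)
    refine ⟨x, w, ?_, ?_, ?_⟩
    · intro e
      induction e using Sym2.ind with
      | _ a b =>
        intro hab
        have hab : G.Adj a b := hab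
        rw [count_edges' w a b hab.ne, hw, hw]
        have := ho1 a b
        have := hEs a b
        split_ifs at * <;> grind
    · intro a b hab he
      have := ho1 a b
      have := hEs a b
      rw [hw, hw]
      split_ifs at * <;> grind
    · intro a b hab he
      have := ho1 a b
      have := hEs a b
      rw [hw, hw]
      split_ifs at * <;> grind
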